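/- arXiv:2404.10688 — 2 statements merged into one kernel-verified Lean document; each statement's English description precedes it below -/
import Mathlib

section
/- Let β : ℝ → ℝ be continuous, α(t) := exp(−∫₀^t β(s) ds), and let μ, x₀, c ∈ ℝ and σ > 0. Define m(t) := μ + √(α(t))·(x₀ − μ), v(t) := (1 − α(t))·σ², and x(t) := m(t) + √(v(t))·c. Then at every t with α(t) < 1, x is differentiable at t and satisfies x'(t) = −(1/2)·β(t)·(x(t) − μ) − (1/2)·β(t)·σ²·s(t), where s(t) := −(x(t) − m(t))/v(t) is the score of the Gaussian density N(m(t), v(t)) evaluated at x(t). (The probability flow ODE of ECDP is solved by the deterministic Gaussian-quantile trajectories of the transition kernel.) -/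
/-- The probability flow ODE of ECDP is solved by the deterministic
Gaussian-quantile trajectories x(t) = m(t) + √(v(t))·c of the transition
kernel: x'(t) = −(1/2)β(t)(x(t) − μ) − (1/2)β(t)σ²·s(t), where
s(t) = −(x(t) − m(t))/v(t) is the score of N(m(t), v(t)) at x(t). -/
theorem ecdp_probability_flow_trajectory
    (β : ℝ → ℝ) (hβ : Continuous β)
    (α : ℝ → ℝ) (hα : ∀ t, α t = Real.exp (-∫ s in (0 : ℝ)..t, β s))
    (μ x₀ c : ℝ) (σ : ℝ) (hσ : 0 < σ)
    (m v x s : ℝ → ℝ)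
    (hm : ∀ t, m t = μ + Real.sqrt (α t) * (x₀ - μ))
    (hv : ∀ t, v t = (1 - α t) * σ ^ 2)
    (hx : ∀ t, x t = m t + Real.sqrt (v t) * c)
    (hs : ∀ t, s t = -(x t - m t) / v t) :
    ∀ t : ℝ, α t < 1 →
      HasDerivAt x (-(1 / 2) * β t * (x t - μ) - (1 / 2) * β t * σ ^ 2 * s t) t := by
  intro t ht
  have hαpos : 0 < α t := by rw [hα]; exact Real.exp_pos _
  have hvpos : 0 < v t := by
    rw [hv]
    have h1 : 0 < 1 - α t := by linarith
    positivity
  have hI : HasDerivAt (fun t => ∫ s in (0 : ℝ)..t, β s) (β t) t :=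
    intervalIntegral.integral_hasDerivAt_right (hβ.intervalIntegrable _ _)
      (hβ.stronglyMeasurableAtFilter _ _) hβ.continuousAt
  have hdα : HasDerivAt α (α t * (-β t)) t := by
    have h := hI.neg.exp
    have e : α = fun t => Real.exp (-∫ s in (0 : ℝ)..t, β s) := funext hα
    rw [e]
    exact h
  have hdv : HasDerivAt v (-(α t * (-β t)) * σ ^ 2) t := by
    have e : v = fun t => (1 - α t) * σ ^ 2 := funext hv
    rw [e]
    exact (hdα.const_sub 1).mul_const _
  have hdx := (((hdα.sqrt hαpos.ne').mul_const (x₀ - μ)).const_add μ).add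
    ((hdv.sqrt hvpos.ne').mul_const c)
  have e : x = fun t => (μ + Real.sqrt (α t) * (x₀ - μ)) + Real.sqrt (v t) * c := by
    funext t; rw [hx, hm]
  have key : HasDerivAt x (α t * -β t / (2 * √(α t)) * (x₀ - μ)
      + -(α t * -β t) * σ ^ 2 / (2 * √(v t)) * c) t := by
    rw [e]; exact hdx
  convert key using 1
  rw [hs, hx, hm]
  have hA : 0 < Real.sqrt (α t) := Real.sqrt_pos.2 hαpos
  have hV : 0 < Real.sqrt (v t) := Real.sqrt_pos.2 hvpos
  have hA2 : Real.sqrt (α t) ^ 2 = α t := Real.sq_sqrt hαpos.le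
  have hV2 : Real.sqrt (v t) ^ 2 = v t := Real.sq_sqrt hvpos.le
  have hvt := hv t
  generalize Real.sqrt (α t) = A at *
  generalize Real.sqrt (v t) = V at *
  rw [← hA2, ← hV2] at hvt
  rw [← hA2, ← hV2]
  field_simp
  linear_combination (-β t * c * V) * hvt
end

section
/- Let σ̂ > 0, let p₀ be a probability measure on ℝ, let m : ℝ → ℝ be measurable, let X₀ be a random variable with law p₀, and let ε be a standard Gaussian random variable independent of X₀. Set X_t := m(X₀) + σ̂·ε and let p_t(x) := ∫ (1/√(2πσ̂²))·exp(−(x − m(a))²/(2σ̂²)) dp₀(a) be the density of X_t. Then for every bounded measurable f : ℝ → ℝ, E[f(X_t)·ε] = −σ̂·∫ f(x)·p_t'(x) dx, where p_t'(x) = ∫ (−(x − m(a))/σ̂²)·(1/√(2πσ̂²))·exp(−(x − m(a))²/(2σ̂²)) dp₀(a). (The noise target −ε/σ̂ of denoising score matching has the same correlations with functions of the noisy state as the marginal score p_t'/p_t, which is why minimizing the denoising loss recovers the marginal score.) -/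
open MeasureTheory ProbabilityTheory

/-- The noise target of denoising score matching has the same correlations with
functions of the noisy state as the marginal score: for every bounded
measurable f, E[f(X_t)·ε] = −σ̂·∫ f(x)·p_t'(x) dx. -/
theorem ecdp_denoising_target_matches_marginal_score
    {Ω : Type*} [MeasurableSpace Ω] (P : Measure Ω) [IsProbabilityMeasure P]
    (σhat : ℝ) (hσ : 0 < σhat)
    (p₀ : Measure ℝ) [IsProbabilityMeasure p₀]
    (m : ℝ → ℝ) (hm : Measurable m)
    (X₀ ε : Ω → ℝ) (hX₀ : Measurable X₀) (hX₀law : Measure.map X₀ P = p₀)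
    (hε : Measurable ε) (hεlaw : Measure.map ε P = gaussianReal 0 1)
    (hindep : IndepFun X₀ ε P)
    (Xt : Ω → ℝ) (hXt : ∀ ω, Xt ω = m (X₀ ω) + σhat * ε ω)
    (pt' : ℝ → ℝ)
    (hpt' : ∀ x, pt' x = ∫ a, (-(x - m a) / σhat ^ 2)
        * ((1 / Real.sqrt (2 * Real.pi * σhat ^ 2))
          * Real.exp (-(x - m a) ^ 2 / (2 * σhat ^ 2))) ∂p₀) :
    ∀ f : ℝ → ℝ, Measurable f → (∃ C : ℝ, ∀ x, |f x| ≤ C) →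
      ∫ ω, f (Xt ω) * ε ω ∂P = -σhat * ∫ x, f x * pt' x := by
  rintro f hf ⟨C, hC⟩
  set K : ℝ → ℝ := fun u => (-u / σhat ^ 2) * ((1 / Real.sqrt (2 * Real.pi * σhat ^ 2))
          * Real.exp (-u ^ 2 / (2 * σhat ^ 2))) with hK
  have hKm : Measurable K := by rw [hK]; fun_prop
  have hKi : Integrable K := by
    have h := (integrable_mul_exp_neg_mul_sq (b := 1 / (2 * σhat ^ 2)) (by positivity)).const_mul
      (-1 / σhat ^ 2 * (1 / Real.sqrt (2 * Real.pi * σhat ^ 2)))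
    refine h.congr (Filter.Eventually.of_forall fun u => ?_)
    have e1 : -u ^ 2 / (2 * σhat ^ 2) = -(1 / (2 * σhat ^ 2)) * u ^ 2 := by ring
    simp only [hK, e1]
    ring
  have hfb : ∀ x, ‖f x‖ ≤ C := hC
  -- right side
  have hR : ∫ x, f x * pt' x = ∫ a, ∫ x, f x * K (x - m a) ∂volume ∂p₀ := by
    have hKp : Integrable (fun z : ℝ × ℝ => K (z.1 - m z.2)) ((volume : Measure ℝ).prod p₀) := by
      rw [integrable_prod_iff' (by fun_prop)]
      refine ⟨Filter.Eventually.of_forall fun a => hKi.comp_sub_right (m a), ?_⟩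
      have : (fun a => ∫ x, ‖K (x - m a)‖) = fun _ => ∫ x, ‖K x‖ := by
        funext a
        exact integral_sub_right_eq_self (fun x => ‖K x‖) (m a)
      simp only [this]
      exact integrable_const _
    have hi : Integrable (fun z : ℝ × ℝ => f z.1 * K (z.1 - m z.2))
        ((volume : Measure ℝ).prod p₀) :=
      hKp.bdd_mul (c := C) (Measurable.aestronglyMeasurable (by fun_prop)) (Filter.Eventually.of_forall fun z => hfb z.1)
    rw [← integral_integral_swap (f := fun x a => f x * K (x - m a)) hi]
    refine integral_congr_ae (Filter.Eventually.of_forall fun x => ?_)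
    simp only [hpt', integral_const_mul, hK]
  have hprod : P.map (fun ω => (X₀ ω, ε ω)) = p₀.prod (gaussianReal 0 1) := by
    rw [(indepFun_iff_map_prod_eq_prod_map_map hX₀.aemeasurable hε.aemeasurable).1 hindep,
      hX₀law, hεlaw]
  have hL : ∫ ω, f (Xt ω) * ε ω ∂P
      = ∫ a, ∫ e, f (m a + σhat * e) * e ∂(gaussianReal 0 1) ∂p₀ := by
    have hid : Integrable (fun e : ℝ => e) (gaussianReal 0 1) :=
      (memLp_id_gaussianReal 1).integrable (by simp)
    have hi : Integrable (fun z : ℝ × ℝ => f (m z.1 + σhat * z.2) * z.2)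
        (p₀.prod (gaussianReal 0 1)) :=
      (hid.comp_snd p₀).bdd_mul (c := C) (Measurable.aestronglyMeasurable (by fun_prop))
        (Filter.Eventually.of_forall fun z => hfb _)
    rw [← integral_prod (fun z : ℝ × ℝ => f (m z.1 + σhat * z.2) * z.2) hi, ← hprod,
      integral_map (by fun_prop) (by fun_prop)]
    simp only [hXt]
  rw [hL, hR, ← integral_const_mul]
  refine integral_congr_ae (Filter.Eventually.of_forall fun a => ?_)
  simp only
  rw [integral_gaussianReal_eq_integral_smul (by simp)]
  have h1 : ∫ x, f x * K (x - m a) = ∫ u, f (m a + u) * K u := by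
    rw [← integral_add_left_eq_self (fun x => f x * K (x - m a)) (m a)]
    simp
  have h2 := Measure.integral_comp_mul_left (fun u => f (m a + u) * K u) σhat
  rw [abs_of_pos (inv_pos.2 hσ), smul_eq_mul, ← h1] at h2
  have h3 : ∫ x, f x * K (x - m a) = σhat * ∫ e, f (m a + σhat * e) * K (σhat * e) := by
    rw [h2]; field_simp
  rw [h3, ← mul_assoc, ← integral_const_mul]
  refine integral_congr_ae (Filter.Eventually.of_forall fun e => ?_)
  have hs : Real.sqrt (2 * Real.pi * σhat ^ 2) = Real.sqrt (2 * Real.pi) * σhat := by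
    rw [Real.sqrt_mul (by positivity), Real.sqrt_sq hσ.le]
  have he : -(σhat * e) ^ 2 / (2 * σhat ^ 2) = -e ^ 2 / 2 := by field_simp
  have hp : Real.sqrt (2 * Real.pi) ≠ 0 := by positivity
  simp only [hK, gaussianPDFReal, hs, he, smul_eq_mul, NNReal.coe_one, mul_one, sub_zero]
  field_simp
end
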